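/- Let D ∈ ℤ^{r×t} and A ∈ ℤ^{s×t}, let E = (D; A), and let G ∈ ℤ^{t×p} be a matrix whose columns are exactly the elements of 𝒢(A). Then for every n ≥ 1 and every g = (g^1,…,g^n) ∈ 𝒢(E^{(n)}), the number of indices i ∈ [n] with g^i ≠ 0 is at most max{‖v‖_1 : v ∈ 𝒢(DG)} (where the maximum over the empty set is taken to be 0). -/

import Mathlib

/-- Two integer vectors are sign-compatible if they lie in the same orthant. -/
def SignCompat {ι : Type*} (x y : ι → ℤ) : Prop := ∀ i, 0 ≤ x i * y i

/-- The conformal order: `y ⊑ x` iff `y` and `x` are sign-compatible and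
`|y i| ≤ |x i|` for every coordinate. -/
def Conforms {ι : Type*} (y x : ι → ℤ) : Prop :=
  SignCompat y x ∧ ∀ i, |y i| ≤ |x i|

/-- The Graver basis of an integer matrix `A`: the set of `⊑`-minimal nonzero
elements of `ker_ℤ(A)`. -/
def GraverBasis {κ ι : Type*} [Fintype ι] (A : Matrix κ ι ℤ) : Set (ι → ℤ) :=
  {g | g ≠ 0 ∧ A.mulVec g = 0 ∧
    ∀ h : ι → ℤ, h ≠ 0 → A.mulVec h = 0 → Conforms h g → h = g}

/-- The `n`-fold product `E^{(n)}` of the bimatrix `E = (D; A)`: the first `r`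
rows are `n` horizontal copies of `D`, below is a block-diagonal matrix with
`n` copies of `A`. Columns are indexed by `Fin n × Fin t` (brick, position). -/
def nFold {r s t : ℕ} (n : ℕ) (D : Matrix (Fin r) (Fin t) ℤ)
    (A : Matrix (Fin s) (Fin t) ℤ) :
    Matrix (Fin r ⊕ (Fin n × Fin s)) (Fin n × Fin t) ℤ :=
  Matrix.of fun I q =>
    match I with
    | Sum.inl a => D a q.2
    | Sum.inr ia => if q.1 = ia.1 then A ia.2 q.2 else 0

theorem conforms_iff {ι : Type*} {y x : ι → ℤ} :
    Conforms y x ↔ ∀ i, (0 ≤ y i ∧ y i ≤ x i) ∨ (x i ≤ y i ∧ y i ≤ 0) := by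
  unfold Conforms SignCompat
  rw [← forall_and]
  refine forall_congr' fun i => ⟨fun ⟨h, h'⟩ => ?_, ?_⟩
  · rcases le_total 0 (y i) with hy | hy <;> rcases le_total 0 (x i) with hx | hx
    · rw [abs_of_nonneg hy, abs_of_nonneg hx] at h'
      exact Or.inl ⟨hy, h'⟩
    · rw [abs_of_nonneg hy, abs_of_nonpos hx] at h'
      rcases mul_nonneg_iff.1 h with h | h <;> omega
    · rw [abs_of_nonpos hy, abs_of_nonneg hx] at h'
      rcases mul_nonneg_iff.1 h with h | h <;> omega
    · rw [abs_of_nonpos hy, abs_of_nonpos hx] at h'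
      exact Or.inr ⟨by omega, hy⟩
  · rintro (⟨h, h'⟩ | ⟨h, h'⟩)
    · exact ⟨mul_nonneg h (h.trans h'), abs_le_abs_of_nonneg h h'⟩
    · exact ⟨mul_nonneg_of_nonpos_of_nonpos h' (h.trans h'), abs_le_abs_of_nonpos h' h⟩

theorem Conforms.refl {ι : Type*} (x : ι → ℤ) : Conforms x x :=
  ⟨fun _ => mul_self_nonneg _, fun _ => le_rfl⟩

theorem Conforms.trans {ι : Type*} {x y z : ι → ℤ} (hxy : Conforms x y) (hyz : Conforms y z) :
    Conforms x z := by
  rw [conforms_iff] at *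
  intro i
  have := hxy i
  have := hyz i
  omega

theorem Conforms.sub_left {ι : Type*} {x y : ι → ℤ} (h : Conforms y x) : Conforms (x - y) x := by
  rw [conforms_iff] at *
  intro i
  have := h i
  simp only [Pi.sub_apply]
  omega

theorem Conforms.sum_natAbs_sub {ι : Type*} [Fintype ι] {x y : ι → ℤ} (h : Conforms y x) :
    ∑ i, (y i).natAbs + ∑ i, ((x - y) i).natAbs = ∑ i, (x i).natAbs := by
  rw [conforms_iff] at h
  rw [← Finset.sum_add_distrib]
  refine Finset.sum_congr rfl fun i _ => ?_
  have := h i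
  simp only [Pi.sub_apply]
  omega

theorem sum_natAbs_pos {ι : Type*} [Fintype ι] {x : ι → ℤ} (hx : x ≠ 0) :
    0 < ∑ i, (x i).natAbs := by
  obtain ⟨i, hi⟩ := Function.ne_iff.1 hx
  exact (Int.natAbs_pos.2 hi).trans_le
    (Finset.single_le_sum (f := fun i => (x i).natAbs) (fun _ _ => Nat.zero_le _)
      (Finset.mem_univ i))

/-- The Graver basis of an integer matrix is finite. -/
theorem GraverBasis.finite {κ ι : Type*} [Fintype ι] (A : Matrix κ ι ℤ) :
    (GraverBasis A).Finite := by
  let φ : (ι → ℤ) → ι → ℕ × ℕ := fun z i => ((z i).toNat, (-z i).toNat)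
  have hφ : Function.Injective φ := by
    intro x y h
    funext i
    have := congrFun h i
    simp only [φ, Prod.mk.injEq] at this
    omega
  have hle : ∀ {x y}, φ y ≤ φ x → Conforms y x := by
    intro x y h
    rw [conforms_iff]
    intro i
    have := h i
    simp only [φ, Prod.mk_le_mk] at this
    omega
  refine Set.Finite.of_finite_image (f := φ) ?_ hφ.injOn
  refine WellQuasiOrderedLE.finite_of_isAntichain ?_
  rintro _ ⟨x, hx, rfl⟩ _ ⟨y, hy, rfl⟩ hne h
  exact hne (congrArg φ (hy.2.2 x hx.1 hx.2.1 (hle h)))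

/-- A kernel element is a conformal nonnegative integer combination of Graver basis elements. -/
theorem exists_conformal_decomposition {κ ι τ : Type*} [Fintype ι] [Fintype τ]
    (A : Matrix κ ι ℤ) (G : Matrix ι τ ℤ)
    (hall : ∀ g ∈ GraverBasis A, ∃ k, (fun j => G j k) = g) (x : ι → ℤ) (hx : A.mulVec x = 0) :
    ∃ c : τ → ℕ, (∀ j, ∑ k, (c k : ℤ) * G j k = x j) ∧
      ∀ k, c k ≠ 0 → Conforms (fun j => G j k) x := by
  classical
  induction hN : ∑ i, (x i).natAbs using Nat.strong_induction_on generalizing x with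
  | _ N ih =>
  subst hN
  by_cases hx0 : x = 0
  · exact ⟨0, by simp [hx0], by simp⟩
  by_cases hg : x ∈ GraverBasis A
  · obtain ⟨k, rfl⟩ := hall x hg
    refine ⟨Pi.single k 1, fun j => ?_, fun l hl => ?_⟩
    · simp [Pi.single_apply]
    · obtain rfl : l = k := by
        by_contra h
        exact hl (Pi.single_eq_of_ne h 1)
      exact Conforms.refl _
  · have : ∃ h : ι → ℤ, h ≠ 0 ∧ A.mulVec h = 0 ∧ Conforms h x ∧ h ≠ x := by
      by_contra! H
      exact hg ⟨hx0, hx, H⟩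
    obtain ⟨h, h0, hA, hc, hne⟩ := this
    have hsum := hc.sum_natAbs_sub
    have hpos := sum_natAbs_pos h0
    have hpos' := sum_natAbs_pos (sub_ne_zero.2 hne.symm)
    obtain ⟨c, hc1, hc2⟩ := ih _ (by omega) h hA rfl
    obtain ⟨d, hd1, hd2⟩ := ih _ (by omega) (x - h)
      (by rw [Matrix.mulVec_sub, hx, hA, sub_zero]) rfl
    refine ⟨c + d, fun j => ?_, fun k hk => ?_⟩
    · simp [add_mul, Finset.sum_add_distrib, hc1, hd1]
    · by_cases hck : c k = 0
      · exact (hd2 k (by simpa [hck] using hk)).trans hc.sub_left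
      · exact (hc2 k hck).trans hc

/-- A vanishing nonnegative combination of nonzero columns from one orthant is trivial. -/
theorem eq_zero_of_conformal_sum_eq_zero {ι τ : Type*} [Fintype τ] {G : Matrix ι τ ℤ}
    (hG : ∀ k, (fun j => G j k) ≠ 0) {x : ι → ℤ} {e : τ → ℕ}
    (he : ∀ k, e k ≠ 0 → Conforms (fun j => G j k) x)
    (hsum : ∀ j, ∑ k, (e k : ℤ) * G j k = 0) : e = 0 := by
  funext k
  by_contra hk
  refine hG k (funext fun j => ?_)
  have hterm : (e k : ℤ) * G j k = 0 := by
    rcases le_total 0 (x j) with hj | hj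
    · refine (Finset.sum_eq_zero_iff_of_nonneg fun l _ => ?_).1 (hsum j) k (Finset.mem_univ k)
      by_cases hl : e l = 0
      · simp [hl]
      · have := conforms_iff.1 (he l hl) j
        exact mul_nonneg (Int.natCast_nonneg _) (by omega)
    · refine (Finset.sum_eq_zero_iff_of_nonpos fun l _ => ?_).1 (hsum j) k (Finset.mem_univ k)
      by_cases hl : e l = 0
      · simp [hl]
      · have := conforms_iff.1 (he l hl) j
        exact mul_nonpos_of_nonneg_of_nonpos (Int.natCast_nonneg _) (by omega)
  exact (mul_eq_zero.1 hterm).resolve_left (Int.natCast_ne_zero.2 hk)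

/-- Subsums of a conformal decomposition of `x` conform to `x`. -/
theorem conforms_subsum {ι τ : Type*} [Fintype τ] {G : Matrix ι τ ℤ} {x : ι → ℤ} {c d : τ → ℕ}
    (hd : d ≤ c) (hc : ∀ k, c k ≠ 0 → Conforms (fun j => G j k) x)
    (hsum : ∀ j, ∑ k, (c k : ℤ) * G j k = x j) :
    Conforms (fun j => ∑ k, (d k : ℤ) * G j k) x := by
  rw [conforms_iff]
  intro j
  have hdc : ∀ k, (d k : ℤ) ≤ c k := fun k => Int.ofNat_le.2 (hd k)
  have hz : ∀ k, c k = 0 → d k = 0 := fun k hk => Nat.le_zero.1 (hk ▸ hd k)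
  rw [← hsum j]
  rcases le_total 0 (x j) with hj | hj
  · have hG : ∀ k, c k ≠ 0 → 0 ≤ G j k := fun k hk => by
      have := conforms_iff.1 (hc k hk) j
      omega
    refine Or.inl ⟨Finset.sum_nonneg fun k _ => ?_, Finset.sum_le_sum fun k _ => ?_⟩ <;>
      by_cases hk : c k = 0
    · simp [hz k hk]
    · exact mul_nonneg (Int.natCast_nonneg _) (hG k hk)
    · simp [hz k hk, hk]
    · exact mul_le_mul_of_nonneg_right (hdc k) (hG k hk)
  · have hG : ∀ k, c k ≠ 0 → G j k ≤ 0 := fun k hk => by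
      have := conforms_iff.1 (hc k hk) j
      omega
    refine Or.inr ⟨Finset.sum_le_sum fun k _ => ?_, Finset.sum_nonpos fun k _ => ?_⟩ <;>
      by_cases hk : c k = 0
    · simp [hz k hk, hk]
    · exact mul_le_mul_of_nonpos_right (hdc k) (hG k hk)
    · simp [hz k hk]
    · exact mul_nonpos_of_nonneg_of_nonpos (Int.natCast_nonneg _) (hG k hk)

/-- A natural number below a finite sum is a sum of numbers below the summands. -/
theorem exists_le_sum_eq_of_le_sum {ι : Type*} (s : Finset ι) (c : ι → ℕ) (w : ℕ)
    (hw : w ≤ ∑ i ∈ s, c i) : ∃ d : ι → ℕ, d ≤ c ∧ ∑ i ∈ s, d i = w := by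
  classical
  induction s using Finset.induction_on generalizing w with
  | empty => exact ⟨0, fun _ => Nat.zero_le _, by simp_all⟩
  | insert a s ha ih =>
    rw [Finset.sum_insert ha] at hw
    obtain ⟨d, hd, hds⟩ := ih (w - min w (c a)) (by omega)
    refine ⟨Function.update d a (min w (c a)), fun i => ?_, ?_⟩
    · by_cases hi : i = a
      · subst hi
        simp
      · simpa [hi] using hd i
    · rw [Finset.sum_insert ha, Finset.sum_update_of_notMem ha, hds, Function.update_self]
      omega

theorem nFold_mulVec_eq_zero_iff {r s t n : ℕ} (D : Matrix (Fin r) (Fin t) ℤ)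
    (A : Matrix (Fin s) (Fin t) ℤ) (x : Fin n × Fin t → ℤ) :
    (nFold n D A).mulVec x = 0 ↔
      (∀ a, ∑ i, ∑ j, D a j * x (i, j) = 0) ∧ ∀ i, A.mulVec (fun j => x (i, j)) = 0 := by
  simp [funext_iff, nFold, Matrix.mulVec, dotProduct, Fintype.sum_prod_type, ite_mul,
    Finset.sum_ite_irrel]

theorem mul_mulVec_sum_eq {ρ ι τ ν : Type*} [Fintype ι] [Fintype τ] [Fintype ν]
    (D : Matrix ρ ι ℤ) (G : Matrix ι τ ℤ) (c : ν → τ → ℕ) (a : ρ) :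
    (D * G).mulVec (fun k => ((∑ i, c i k : ℕ) : ℤ)) a =
      ∑ i, ∑ j, D a j * ∑ k, (c i k : ℤ) * G j k := by
  have : (fun k => ((∑ i, c i k : ℕ) : ℤ)) = ∑ i, fun k => (c i k : ℤ) := by
    funext k
    simp
  rw [this, ← Matrix.mulVec_mulVec, Matrix.mulVec_sum, Matrix.mulVec_sum, Finset.sum_apply]
  simp [Matrix.mulVec, dotProduct, mul_comm]

/-- For every `g ∈ 𝒢(E^{(n)})`, the number of nonzero bricks of `g` is at most
`max{‖v‖₁ : v ∈ 𝒢(DG)}`, where the columns of `G` are exactly the elements of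
`𝒢(A)` (the max over the empty set being `0`, as `sSup ∅ = 0` in `ℕ`). -/
theorem nfold_graver_nonzero_bricks {r s t p n : ℕ} (hn : 1 ≤ n)
    (D : Matrix (Fin r) (Fin t) ℤ) (A : Matrix (Fin s) (Fin t) ℤ)
    (G : Matrix (Fin t) (Fin p) ℤ)
    (hcols : ∀ k : Fin p, (fun j => G j k) ∈ GraverBasis A)
    (hall : ∀ g ∈ GraverBasis A, ∃ k : Fin p, (fun j => G j k) = g)
    (hinj : Function.Injective (fun (k : Fin p) (j : Fin t) => G j k))
    (g : Fin n × Fin t → ℤ) (hg : g ∈ GraverBasis (nFold n D A)) :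
    (Finset.univ.filter fun i : Fin n => (fun j => g (i, j)) ≠ 0).card ≤
      sSup {M : ℕ | ∃ v ∈ GraverBasis (D * G), M = ∑ k, (v k).natAbs} := by
  have hker := (nFold_mulVec_eq_zero_iff D A g).1 hg.2.1
  choose c hcsum hcconf using fun i =>
    exists_conformal_decomposition A G hall (fun j => g (i, j)) (hker.2 i)
  have hG : ∀ k, (fun j => G j k) ≠ 0 := fun k => (hcols k).1
  have hAG : ∀ d : Fin p → ℕ, A.mulVec (fun j => ∑ k, (d k : ℤ) * G j k) = 0 := by
    intro d
    have hcol : (fun j => ∑ k, (d k : ℤ) * G j k) = ∑ k, (d k : ℤ) • fun j => G j k := by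
      funext j
      simp
    rw [hcol, Matrix.mulVec_sum]
    refine Finset.sum_eq_zero fun k _ => ?_
    rw [Matrix.mulVec_smul, (hcols k).2.1, smul_zero]
  have hv : (fun k => ((∑ i, c i k : ℕ) : ℤ)) ∈ GraverBasis (D * G) := by
    refine ⟨fun h0 => hg.1 ?_, ?_, fun w hw0 hwker hwv => ?_⟩
    · funext ⟨i, j⟩
      have hci : ∀ k, c i k = 0 := fun k =>
        Finset.sum_eq_zero_iff.1 (Int.natCast_eq_zero.1 (congrFun h0 k)) i (Finset.mem_univ i)
      rw [← hcsum i j]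
      simp [hci]
    · funext a
      rw [mul_mulVec_sum_eq]
      simpa only [hcsum, Pi.zero_apply] using hker.1 a
    · rw [conforms_iff] at hwv
      choose d hdc hdw using fun k =>
        exists_le_sum_eq_of_le_sum Finset.univ (fun i => c i k) (w k).toNat (by
          have := hwv k
          omega)
      have hw : w = fun k => ((∑ i, d k i : ℕ) : ℤ) := by
        funext k
        have := hwv k
        rw [hdw k]
        omega
      let e : Fin n → Fin p → ℕ := fun i k => d k i
      have hec : ∀ i, e i ≤ c i := fun i k => hdc k i
      let h : Fin n × Fin t → ℤ := fun q => ∑ k, (e q.1 k : ℤ) * G q.2 k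
      have hconf : Conforms h g := by
        have := fun i => conforms_subsum (hec i) (hcconf i) (hcsum i)
        exact ⟨fun q => (this q.1).1 q.2, fun q => (this q.1).2 q.2⟩
      have hh0 : h ≠ 0 := by
        intro hh
        refine hw0 (hw.trans (funext fun k => ?_))
        have he : ∀ i, e i = 0 := fun i =>
          eq_zero_of_conformal_sum_eq_zero hG
            (fun l hl => hcconf i l fun h0 => hl (Nat.le_zero.1 (h0 ▸ hec i l)))
            fun j => congrFun hh (i, j)
        exact Int.natCast_eq_zero.2 (Finset.sum_eq_zero fun i _ => congrFun (he i) k)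
      have hhker : (nFold n D A).mulVec h = 0 := by
        refine (nFold_mulVec_eq_zero_iff D A h).2 ⟨fun a => ?_, fun i => hAG (e i)⟩
        rw [hw] at hwker
        exact (mul_mulVec_sum_eq D G e a).symm.trans (congrFun hwker a)
      have hhg : h = g := hg.2.2 h hh0 hhker hconf
      have hce : ∀ i, c i - e i = 0 := fun i => by
        refine eq_zero_of_conformal_sum_eq_zero hG
          (fun l hl => hcconf i l fun h0 => hl (by simp [h0])) fun j => ?_
        have h1 : ∑ k, (e i k : ℤ) * G j k = g (i, j) := congrFun hhg (i, j)
        rw [← sub_eq_zero.2 ((hcsum i j).trans h1.symm), ← Finset.sum_sub_distrib]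
        refine Finset.sum_congr rfl fun k _ => ?_
        rw [Pi.sub_apply, Nat.cast_sub (hec i k), sub_mul]
      rw [hw]
      funext k
      refine congrArg Nat.cast (Finset.sum_congr rfl fun i _ => ?_)
      exact (hec i k).antisymm (Nat.sub_eq_zero_iff_le.1 (congrFun (hce i) k))
  have hbdd : BddAbove {M : ℕ | ∃ v ∈ GraverBasis (D * G), M = ∑ k, (v k).natAbs} := by
    refine (((GraverBasis.finite (D * G)).image fun v => ∑ k, (v k).natAbs).subset ?_).bddAbove
    rintro _ ⟨v, hv, rfl⟩
    exact ⟨v, hv, rfl⟩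
  refine le_trans ?_ (le_csSup hbdd ⟨_, hv, rfl⟩)
  simp only [Int.natAbs_natCast]
  rw [Finset.sum_comm, Finset.card_eq_sum_ones]
  refine (Finset.sum_le_sum fun i hi => ?_).trans
    (Finset.sum_le_sum_of_subset (Finset.filter_subset _ _))
  by_contra hlt
  have hz : ∑ k, c i k = 0 := by omega
  refine (Finset.mem_filter.1 hi).2 (funext fun j => ?_)
  rw [← hcsum i j]
  refine Finset.sum_eq_zero fun k hk => ?_
  simp [Finset.sum_eq_zero_iff.1 hz k hk]
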